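/- arXiv:1804.09897 — 2 statements merged into one kernel-verified Lean document; each statement's English description precedes it below -/
import Mathlib

section
/- Let S be a quasi completely regular semiring with least b-lattice congruence ξ, and let a, b ∈ S lie in the same ξ-class. Then a 𝒴 b if and only if for every x in the ξ-class of a, one has a+0_a = 0_{(a+0_a+x)}+b+0_b+0_{(x+a+0_a)} and b+0_b = 0_{(b+0_b+x)}+a+0_a+0_{(x+b+0_b)}. -/
/-- A "semiring" in the sense of the paper: both reducts are semigroups
(no commutativity, no identities) and multiplication distributes over
addition on both sides. -/
class PSemiring (S : Type*) extends AddSemigroup S, Semigroup S where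
  left_distrib : ∀ a b c : S, a * (b + c) = a * b + a * c
  right_distrib : ∀ a b c : S, (a + b) * c = a * c + b * c

namespace PSemiring

variable {S : Type*} [PSemiring S]

/-- `nmul n a` is the `(n+1)`-fold sum `a + ⋯ + a`; thus the positive
multiple `m·a` of the paper is `nmul (m-1) a`. -/
def nmul : ℕ → S → S
  | 0, a => a
  | n + 1, a => nmul n a + a

/-- `a` is additively regular. -/
def AddRegular (a : S) : Prop := ∃ x, a + x + a = a

/-- `a` is a completely regular element. -/
def CompletelyRegularElem (a : S) : Prop :=
  ∃ x, a = a + x + a ∧ a + x = x + a ∧ a * (a + x) = a + x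

/-- `S` is a quasi completely regular semiring. -/
def QuasiCompletelyRegular (S : Type*) [PSemiring S] : Prop :=
  ∀ a : S, ∃ n : ℕ, CompletelyRegularElem (nmul n a)

/-- `S` is a completely regular semiring. -/
def CompletelyRegularSemiring (S : Type*) [PSemiring S] : Prop :=
  ∀ a : S, CompletelyRegularElem a

/-- `e` is an additive idempotent (i.e. `e ∈ E⁺(S)`). -/
def AddIdem (e : S) : Prop := e + e = e

/-- `V⁺(a)`, the set of additive inverses of `a`. -/
def Vplus (a : S) : Set S := {x | a + x + a = a ∧ x + a + x = x}

/-- `{a} ∪ (S + a)`. -/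
def lset (a : S) : Set S := insert a {x | ∃ s, x = s + a}

/-- `{a} ∪ (a + S)`. -/
def rset (a : S) : Set S := insert a {x | ∃ s, x = a + s}

/-- `{a} ∪ (S + a) ∪ (a + S) ∪ (S + a + S)`. -/
def jset (a : S) : Set S :=
  insert a ({x | ∃ s, x = s + a} ∪ {x | ∃ s, x = a + s} ∪ {x | ∃ s t, x = s + a + t})

/-- Green's relation `L⁺` on the additive reduct. -/
def GreenL (a b : S) : Prop := lset a = lset b

/-- Green's relation `R⁺` on the additive reduct. -/
def GreenR (a b : S) : Prop := rset a = rset b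

/-- Green's relation `J⁺` on the additive reduct. -/
def GreenJ (a b : S) : Prop := jset a = jset b

/-- `n` is the least index such that the `(n+1)`-fold sum of `a` is additively
regular, i.e. `(n+1)·a` is the least additively regular positive multiple. -/
def LeastReg (a : S) (n : ℕ) : Prop :=
  AddRegular (nmul n a) ∧ ∀ m < n, ¬ AddRegular (nmul m a)

/-- The relation `L*⁺`. -/
def LStar (a b : S) : Prop :=
  ∃ p q, LeastReg a p ∧ LeastReg b q ∧ GreenL (nmul p a) (nmul q b)

/-- The relation `R*⁺`. -/
def RStar (a b : S) : Prop :=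
  ∃ p q, LeastReg a p ∧ LeastReg b q ∧ GreenR (nmul p a) (nmul q b)

/-- The relation `J*⁺`. -/
def JStar (a b : S) : Prop :=
  ∃ p q, LeastReg a p ∧ LeastReg b q ∧ GreenJ (nmul p a) (nmul q b)

/-- `H*⁺ = L*⁺ ∩ R*⁺`. -/
def HStar (a b : S) : Prop := LStar a b ∧ RStar a b

/-- `D*⁺ = L*⁺ ∘ R*⁺` (relational composition). -/
def DStar (a b : S) : Prop := ∃ c, LStar a c ∧ RStar c b

/-- `z = 0_a`: `z = na + x` where `n` is the least positive integer with `na`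
completely regular and `x` is the (unique) element with `na = na+x+na`,
`x = x+na+x` and `na+x = x+na`. -/
def IsZeroOf (a z : S) : Prop :=
  ∃ n x, (CompletelyRegularElem (nmul n a) ∧
      ∀ m < n, ¬ CompletelyRegularElem (nmul m a)) ∧
    nmul n a = nmul n a + x + nmul n a ∧ x = x + nmul n a + x ∧
    nmul n a + x = x + nmul n a ∧ z = nmul n a + x

/-- The relation `𝒴`, relative to a choice `z` of the map `a ↦ 0_a`. -/
def Yrel (z : S → S) (a b : S) : Prop := Vplus (a + z a) = Vplus (b + z b)

/-- A (semiring) congruence. -/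
structure IsCong (r : S → S → Prop) : Prop where
  refl : ∀ a, r a a
  symm : ∀ {a b}, r a b → r b a
  trans : ∀ {a b c}, r a b → r b c → r a c
  addl : ∀ (c : S) {a b}, r a b → r (c + a) (c + b)
  addr : ∀ (c : S) {a b}, r a b → r (a + c) (b + c)
  mull : ∀ (c : S) {a b}, r a b → r (c * a) (c * b)
  mulr : ∀ (c : S) {a b}, r a b → r (a * c) (b * c)

/-- `r` is a b-lattice congruence: `S/r` is a b-lattice. -/
def IsBLatticeCong (r : S → S → Prop) : Prop :=
  IsCong r ∧ (∀ a : S, r (a * a) a) ∧ (∀ a : S, r (a + a) a) ∧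
    ∀ a b : S, r (a + b) (b + a)

/-- `r` is the least b-lattice congruence. -/
def IsLeastBLatticeCong (r : S → S → Prop) : Prop :=
  IsBLatticeCong r ∧ ∀ r', IsBLatticeCong r' → ∀ a b, r a b → r' a b

/-- `r` is a skew-ring congruence: `S/r` is a semiring whose additive reduct
is a group (expressed by solvability of both translation equations). -/
def IsSkewRingCong (r : S → S → Prop) : Prop :=
  IsCong r ∧ ∀ a b : S, (∃ x, r (a + x) b) ∧ ∃ y, r (y + a) b

/-- `r` is the least skew-ring congruence. -/
def IsLeastSkewRingCong (r : S → S → Prop) : Prop :=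
  IsSkewRingCong r ∧ ∀ r', IsSkewRingCong r' → ∀ a b, r a b → r' a b

/-- `η` is a b-lattice-of-skew-rings congruence: `S/η` admits a congruence `ξ`
(given here as a congruence on `S` containing `η`) such that `(S/η)/ξ` is a
b-lattice and every `ξ`-class of `S/η` is a subsemiring whose additive reduct
is a group. -/
def IsBLSRCong (η : S → S → Prop) : Prop :=
  IsCong η ∧ ∃ ξ : S → S → Prop, IsCong ξ ∧ (∀ a b, η a b → ξ a b) ∧
    (∀ a : S, ξ (a * a) a) ∧ (∀ a : S, ξ (a + a) a) ∧
    (∀ a b : S, ξ (a + b) (b + a)) ∧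
    (∀ a b, ξ a b → ξ (a + b) a ∧ ξ (a * b) a) ∧
    ∀ a b, ξ a b → (∃ x, ξ x a ∧ η (a + x) b) ∧ ∃ y, ξ y a ∧ η (y + a) b

/-- `ν` is the least b-lattice-of-skew-rings congruence. -/
def IsLeastBLSRCong (ν : S → S → Prop) : Prop :=
  IsBLSRCong ν ∧ ∀ η, IsBLSRCong η → ∀ a b, ν a b → η a b

/-- `r` is a completely regular semiring congruence: `S/r` is completely
regular. -/
def IsCRCong (r : S → S → Prop) : Prop :=
  IsCong r ∧ ∀ a : S, ∃ x, r a (a + x + a) ∧ r (a + x) (x + a) ∧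
    r (a * (a + x)) (a + x)

/-- `ρ` is the least completely regular semiring congruence. -/
def IsLeastCRCong (r : S → S → Prop) : Prop :=
  IsCRCong r ∧ ∀ r', IsCRCong r' → ∀ a b, r a b → r' a b

/-- `S` is quasi-orthodox. -/
def QuasiOrthodox (S : Type*) [PSemiring S] : Prop :=
  ∀ e f : S, AddIdem e → AddIdem f →
    ∃ n : ℕ, nmul n (e + f) = nmul (n + 1) (e + f)

/-- `S` is a completely Archimedean semiring. -/
def CompletelyArchimedean (S : Type*) [PSemiring S] : Prop :=
  QuasiCompletelyRegular S ∧ ∀ a b : S, JStar a b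

/-- `r` is the least congruence containing the relation `τ`. -/
def IsLeastCongContaining (τ r : S → S → Prop) : Prop :=
  IsCong r ∧ (∀ a b, τ a b → r a b) ∧
    ∀ r', IsCong r' → (∀ a b, τ a b → r' a b) → ∀ a b, r a b → r' a b

/-- `r` is a generalized additive idempotent pure congruence (purity part). -/
def GenAddIdemPure (r : S → S → Prop) : Prop :=
  ∀ a e : S, AddIdem e → r a e → ∃ n : ℕ, nmul n a = nmul (n + 1) a

/-- `τ^e`: `a = x + c + y`, `b = x + d + y` for some `(c,d) ∈ τ`, where each of
`x`, `y` may also be absent (i.e. `x, y ∈ S⁰`). -/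
def relE (τ : S → S → Prop) (a b : S) : Prop :=
  ∃ c d, τ c d ∧ ((a = c ∧ b = d) ∨ (∃ x, a = x + c ∧ b = x + d) ∨
    (∃ y, a = c + y ∧ b = d + y) ∨ ∃ x y, a = x + c + y ∧ b = x + d + y)

/-- `τ^♮`: the transitive closure of `(τ ∪ τ⁻¹ ∪ ε)^e`. -/
def natClosure (τ : S → S → Prop) : S → S → Prop :=
  Relation.TransGen (relE (fun a b => τ a b ∨ τ b a ∨ a = b))

end PSemiring

open PSemiring

namespace PSemiring

variable {S : Type*} [PSemiring S]

/-- `e` lies in `S + u + S`. -/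
def AddFactor (e u : S) : Prop := ∃ s t, e = s + u + t

/-- `u` lies in an additive subgroup with identity `h`. -/
def InGroup (u h : S) : Prop :=
  h + h = h ∧ h + u = u ∧ u + h = u ∧ ∃ v, u + v = h ∧ v + u = h ∧ h + v = v ∧ v + h = v

theorem nmul_add_nmul (c : S) (m n : ℕ) : nmul m c + nmul n c = nmul (m + n + 1) c := by
  induction n with
  | zero => rfl
  | succ n ih =>
    change nmul m c + (nmul n c + c) = nmul (m + n + 1) c + c
    rw [← add_assoc, ih]

theorem nmul_add_comm (a : S) (n : ℕ) : nmul n a + a = a + nmul n a := by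
  have h := nmul_add_nmul a 0 n
  rw [Nat.zero_add] at h
  exact h.symm

theorem nmul_nmul (c : S) (k n : ℕ) : nmul k (nmul n c) = nmul (k * n + k + n) c := by
  induction k with
  | zero => simp [nmul]
  | succ k ih =>
    change nmul k (nmul n c) + nmul n c = _
    rw [ih, nmul_add_nmul]
    congr 1
    ring

theorem mul_nmul (x c : S) (n : ℕ) : x * nmul n c = nmul n (x * c) := by
  induction n with
  | zero => rfl
  | succ n ih =>
    change x * (nmul n c + c) = nmul n (x * c) + x * c
    rw [PSemiring.left_distrib, ih]

theorem nmul_mul (x c : S) (n : ℕ) : nmul n c * x = nmul n (c * x) := by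
  induction n with
  | zero => rfl
  | succ n ih =>
    change (nmul n c + c) * x = nmul n (c * x) + c * x
    rw [PSemiring.right_distrib, ih]

theorem AddIdem.nmul_eq {e : S} (he : AddIdem e) (n : ℕ) : nmul n e = e := by
  induction n with
  | zero => rfl
  | succ n ih =>
    change nmul n e + e = e
    rw [ih, he]

theorem AddIdem.mul_left {e : S} (he : AddIdem e) (x : S) : AddIdem (x * e) := by
  rw [AddIdem, ← PSemiring.left_distrib, he]

theorem AddIdem.mul_right {e : S} (he : AddIdem e) (x : S) : AddIdem (e * x) := by
  rw [AddIdem, ← PSemiring.right_distrib, he]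

theorem AddIdem.inGroup {e : S} (he : AddIdem e) : InGroup e e :=
  ⟨he, he, he, e, he, he, he, he⟩

theorem InGroup.addIdem {u h : S} (hu : InGroup u h) : AddIdem h := hu.1

theorem inGroup_of_add_eq {u h p q : S} (h1 : h + h = h) (h2 : h + u = u) (h3 : u + h = u)
    (h4 : u + p = h) (h5 : q + u = h) : InGroup u h := by
  have e : h + p = q + h := by
    calc h + p = q + u + p := by rw [h5]
      _ = q + h := by rw [add_assoc, h4]
  refine ⟨h1, h2, h3, h + p + h, ?_, ?_, ?_, ?_⟩
  · rw [← add_assoc, ← add_assoc, h3, h4, h1]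
  · rw [add_assoc, h2, e, add_assoc, h2, h5]
  · rw [← add_assoc, ← add_assoc, h1]
  · rw [add_assoc, h1]

theorem InGroup.unique {u h k : S} (hu : InGroup u h) (ku : InGroup u k) : h = k := by
  obtain ⟨h1, h2, h3, v, h4, h5, h6, h7⟩ := hu
  obtain ⟨k1, k2, k3, w, k4, k5, k6, k7⟩ := ku
  have e1 : h + k = h := by rw [← h5, add_assoc, k3]
  have e2 : h + k = k := by rw [← k4, ← add_assoc, h2]
  rw [← e1, e2]

theorem InGroup.add {u v h : S} (hu : InGroup u h) (hv : InGroup v h) : InGroup (u + v) h := by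
  obtain ⟨h1, h2, h3, p, h4, h5, h6, h7⟩ := hu
  obtain ⟨k1, k2, k3, q, k4, k5, k6, k7⟩ := hv
  refine ⟨h1, ?_, ?_, q + p, ?_, ?_, ?_, ?_⟩ <;> grind

theorem InGroup.nmul {u h : S} (hu : InGroup u h) (n : ℕ) : InGroup (nmul n u) h := by
  induction n with
  | zero => exact hu
  | succ n ih => exact ih.add hu

theorem InGroup.mul_left {u h : S} (hu : InGroup u h) (x : S) : InGroup (x * u) (x * h) := by
  obtain ⟨h1, h2, h3, p, h4, h5, h6, h7⟩ := hu
  refine ⟨?_, ?_, ?_, x * p, ?_, ?_, ?_, ?_⟩ <;> rw [← PSemiring.left_distrib] <;> congr 1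

theorem InGroup.mul_right {u h : S} (hu : InGroup u h) (x : S) : InGroup (u * x) (h * x) := by
  obtain ⟨h1, h2, h3, p, h4, h5, h6, h7⟩ := hu
  refine ⟨?_, ?_, ?_, p * x, ?_, ?_, ?_, ?_⟩ <;> rw [← PSemiring.right_distrib] <;> congr 1

theorem inGroup_of_eq {u x : S} (h1 : u = u + x + u) (h2 : u + x = x + u) :
    InGroup u (u + x) := by
  refine ⟨?_, ?_, ?_, x + u + x, ?_, ?_, ?_, ?_⟩ <;> grind

theorem IsZeroOf.exists_inGroup {a e : S} (h : IsZeroOf a e) :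
    ∃ n, InGroup (nmul n a) e ∧ nmul n a * e = e := by
  obtain ⟨n, x, ⟨⟨y, hy1, hy2, hy3⟩, -⟩, h1, -, h3, rfl⟩ := h
  have hg := inGroup_of_eq h1 h3
  refine ⟨n, hg, ?_⟩
  rw [hg.unique (inGroup_of_eq hy1 hy2), hy3]

section Zero

variable {z : S → S}

theorem zero_eq_of_inGroup (hz : ∀ a : S, IsZeroOf a (z a)) {a h : S} {n : ℕ}
    (h1 : InGroup (nmul n a) h) : z a = h := by
  obtain ⟨m, h2, -⟩ := (hz a).exists_inGroup
  have e1 := h1.nmul m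
  have e2 := h2.nmul n
  rw [nmul_nmul] at e1 e2
  rw [show n * m + n + m = m * n + m + n by ring] at e2
  exact e2.unique e1

theorem zero_addIdem (hz : ∀ a : S, IsZeroOf a (z a)) (a : S) : AddIdem (z a) := by
  obtain ⟨_, h, -⟩ := (hz a).exists_inGroup
  exact h.addIdem

theorem AddIdem.zero_eq (hz : ∀ a : S, IsZeroOf a (z a)) {e : S} (he : AddIdem e) : z e = e :=
  zero_eq_of_inGroup hz (n := 0) he.inGroup

theorem zero_mul_left (hz : ∀ a : S, IsZeroOf a (z a)) (x c : S) : z (x * c) = x * z c := by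
  obtain ⟨n, h, -⟩ := (hz c).exists_inGroup
  refine zero_eq_of_inGroup hz (n := n) ?_
  rw [← mul_nmul]
  exact h.mul_left x

theorem zero_mul_right (hz : ∀ a : S, IsZeroOf a (z a)) (x c : S) : z (c * x) = z c * x := by
  obtain ⟨n, h, -⟩ := (hz c).exists_inGroup
  refine zero_eq_of_inGroup hz (n := n) ?_
  rw [← nmul_mul]
  exact h.mul_right x

theorem mul_zero_self (hz : ∀ a : S, IsZeroOf a (z a)) (a : S) : a * z a = z a := by
  obtain ⟨n, -, h⟩ := (hz a).exists_inGroup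
  rwa [nmul_mul, ((zero_addIdem hz a).mul_left a).nmul_eq] at h

theorem AddIdem.mul_self (hz : ∀ a : S, IsZeroOf a (z a)) {e : S} (he : AddIdem e) :
    e * e = e := by
  have := mul_zero_self hz e
  rwa [he.zero_eq hz] at this

theorem AddIdem.mul_zero_eq (hz : ∀ a : S, IsZeroOf a (z a)) {e : S} (he : AddIdem e) (c : S) :
    e * z c = e * c := by
  rw [← zero_mul_left hz, (he.mul_right c).zero_eq hz]

/-- Additively regular elements lie in additive subgroups. -/
theorem inGroup_zero_of_regular (hz : ∀ a : S, IsZeroOf a (z a)) {a : S} (ha : AddRegular a) :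
    InGroup a (z a) := by
  obtain ⟨x, hx⟩ := ha
  obtain ⟨n, hn, -⟩ := (hz a).exists_inGroup
  set h := z a with hh
  have hi : AddIdem h := hn.addIdem
  have ah : a * h = h := mul_zero_self hz a
  have key1 : h + (a + x) = a + x := by
    have he : AddIdem (a + x) := by rw [AddIdem, ← add_assoc, hx]
    set e := a + x with hee
    have e1 : e * h = e * a := he.mul_zero_eq hz a
    have e2 : e * h = h + x * h := by rw [hee, PSemiring.right_distrib, ah]
    have e3 : e = e * a + e * x := by rw [← PSemiring.left_distrib, ← hee, he.mul_self hz]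
    have e5 : e * a = h + x * h := e1.symm.trans e2
    have e6 : e = h + (x * h + e * x) := by rw [← add_assoc, ← e5, ← e3]
    rw [e6, ← add_assoc, hi]
  have key2 : (x + a) + h = x + a := by
    have he : AddIdem (x + a) := by rw [AddIdem, ← add_assoc, add_assoc x, add_assoc x, hx]
    set e := x + a with hee
    have e1 : e * h = e * a := he.mul_zero_eq hz a
    have e2 : e * h = x * h + h := by rw [hee, PSemiring.right_distrib, ah]
    have e3 : e = e * x + e * a := by rw [← PSemiring.left_distrib, ← hee, he.mul_self hz]
    have e5 : e * a = x * h + h := e1.symm.trans e2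
    have e6 : e = e * x + x * h + h := by rw [add_assoc, ← e5, ← e3]
    rw [e6, add_assoc, hi]
  have l : h + a = a := by rw [← hx, ← add_assoc, key1]
  have r : a + h = a := by rw [← hx, add_assoc a, add_assoc a, key2]
  obtain ⟨h1, h2, h3, v, h4, h5, h6, h7⟩ := hn
  cases n with
  | zero => exact ⟨h1, l, r, v, h4, h5, h6, h7⟩
  | succ n =>
    have e1 := nmul_add_comm a n
    change nmul n a + a + v = h at h4
    change v + (nmul n a + a) = h at h5
    exact inGroup_of_add_eq h1 l r (p := nmul n a + v) (q := v + nmul n a)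
      (by rw [← add_assoc, ← e1, h4]) (by rw [add_assoc, h5])

theorem AddFactor.refl {e : S} (he : AddIdem e) : AddFactor e e :=
  ⟨e, e, by rw [he, he]⟩

theorem AddFactor.trans {e f u : S} (h1 : AddFactor e f) (h2 : AddFactor f u) : AddFactor e u := by
  obtain ⟨s, t, rfl⟩ := h1
  obtain ⟨p, q, rfl⟩ := h2
  exact ⟨s + p, q + t, by simp only [add_assoc]⟩

theorem AddFactor.left {e u v : S} (h : AddFactor e (u + v)) : AddFactor e u := by
  obtain ⟨s, t, rfl⟩ := h
  exact ⟨s, v + t, by simp only [add_assoc]⟩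

theorem AddFactor.right {e u v : S} (h : AddFactor e (u + v)) : AddFactor e v := by
  obtain ⟨s, t, rfl⟩ := h
  exact ⟨s + u, t, by simp only [add_assoc]⟩

theorem AddFactor.mul_left {e u : S} (h : AddFactor e u) (x : S) : AddFactor (x * e) (x * u) := by
  obtain ⟨s, t, rfl⟩ := h
  exact ⟨x * s, x * t, by simp only [PSemiring.left_distrib]⟩

theorem AddFactor.mul_right {e u : S} (h : AddFactor e u) (x : S) :
    AddFactor (e * x) (u * x) := by
  obtain ⟨s, t, rfl⟩ := h
  exact ⟨s * x, t * x, by simp only [PSemiring.right_distrib]⟩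

theorem AddFactor.exists_eq_add {e u v : S} (he : AddIdem e) (hu : AddFactor e u)
    (hv : AddFactor e v) : ∃ s m t, e = s + (v + m + u) + t := by
  obtain ⟨s, t, h1⟩ := hu
  obtain ⟨p, q, h2⟩ := hv
  refine ⟨p, q + s, t, ?_⟩
  rw [AddIdem] at he
  nth_rw 1 [← he, h2, h1]
  simp only [add_assoc]

theorem AddFactor.of_add_idem {e s u v m t : S} (h : e = s + (v + m + u) + t)
    (hi : AddIdem (v + m + u)) : AddFactor e (u + v) := by
  refine ⟨s + v + m, m + u + t, ?_⟩
  rw [h, ← hi]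
  simp only [add_assoc]

theorem zero_addFactor_self (hz : ∀ a : S, IsZeroOf a (z a)) (c : S) : AddFactor (z c) c := by
  obtain ⟨n, ⟨-, h2, -, v, h4, -⟩, -⟩ := (hz c).exists_inGroup
  cases n with
  | zero => exact ⟨z c, v, (h4.symm.trans (congrArg (· + v) h2.symm))⟩
  | succ n => exact ⟨nmul n c, v, h4.symm⟩

theorem zero_addFactor_iff (hz : ∀ a : S, IsZeroOf a (z a)) {e u : S} (he : AddIdem e) :
    AddFactor e (z u) ↔ AddFactor e u := by
  refine ⟨fun h ↦ h.trans (zero_addFactor_self hz u), fun h ↦ ?_⟩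
  have h1 := h.mul_left e
  rw [he.mul_self hz, ← he.mul_zero_eq hz] at h1
  have h2 := h.mul_right (z u)
  rw [mul_zero_self hz] at h2
  exact h1.trans h2

theorem AddFactor.add (hz : ∀ a : S, IsZeroOf a (z a)) {e u v : S} (he : AddIdem e)
    (hu : AddFactor e u) (hv : AddFactor e v) : AddFactor e (u + v) := by
  obtain ⟨s, m, t, h⟩ := AddFactor.exists_eq_add he hu hv
  set g := z (u + v) with hg
  have hgi : AddIdem g := zero_addIdem hz _
  have key1 : AddFactor e (e * g) := by
    rw [he.mul_zero_eq hz, PSemiring.left_distrib]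
    refine AddFactor.of_add_idem (s := e * s) (m := e * m) (t := e * t) ?_ ?_
    · simp only [← PSemiring.left_distrib]
      rw [← h, he.mul_self hz]
    · simp only [← PSemiring.left_distrib]
      exact he.mul_right _
  have key2 : AddFactor (e * g) g := by
    have h1 : g = u * g + v * g := by rw [← PSemiring.right_distrib, mul_zero_self hz]
    nth_rw 2 [h1]
    refine AddFactor.of_add_idem (s := s * g) (m := m * g) (t := t * g) ?_ ?_
    · simp only [← PSemiring.right_distrib]
      rw [← h]
    · simp only [← PSemiring.right_distrib]
      exact hgi.mul_left _
  exact (key1.trans key2).trans (zero_addFactor_self hz _)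

theorem isBLatticeCong_zero (hz : ∀ a : S, IsZeroOf a (z a)) :
    IsBLatticeCong fun c d : S ↦ AddFactor (z c) d ∧ AddFactor (z d) c := by
  have idem := zero_addIdem hz
  have self := zero_addFactor_self hz
  have tr : ∀ {e c d : S}, AddIdem e → AddFactor e c → AddFactor (z c) d → AddFactor e d :=
    fun he h1 h2 ↦ ((zero_addFactor_iff hz he).2 h1).trans h2
  refine ⟨⟨fun a ↦ ⟨self a, self a⟩, fun h ↦ ⟨h.2, h.1⟩,
    fun h1 h2 ↦ ⟨tr (idem _) h1.1 h2.1, tr (idem _) h2.2 h1.2⟩, ?_, ?_, ?_, ?_⟩, ?_, ?_, ?_⟩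
  · have aux : ∀ c a b : S, AddFactor (z a) b → AddFactor (z (c + a)) (c + b) := fun c a b h ↦
      (self (c + a)).left.add hz (idem _) (tr (idem _) (self (c + a)).right h)
    exact fun c a b h ↦ ⟨aux c a b h.1, aux c b a h.2⟩
  · have aux : ∀ c a b : S, AddFactor (z a) b → AddFactor (z (a + c)) (b + c) := fun c a b h ↦
      (tr (idem _) (self (a + c)).left h).add hz (idem _) (self (a + c)).right
    exact fun c a b h ↦ ⟨aux c a b h.1, aux c b a h.2⟩
  · intro c a b h
    simp only [zero_mul_left hz]
    exact ⟨h.1.mul_left c, h.2.mul_left c⟩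
  · intro c a b h
    simp only [zero_mul_right hz]
    exact ⟨h.1.mul_right c, h.2.mul_right c⟩
  · intro a
    have h1 : z (a * a) = z a := by rw [zero_mul_left hz, mul_zero_self hz]
    have h2 := self (a * a)
    rw [h1] at h2 ⊢
    exact ⟨self a, h2⟩
  · exact fun a ↦ ⟨(self (a + a)).left, (self a).add hz (idem a) (self a)⟩
  · exact fun a b ↦ ⟨(self (a + b)).right.add hz (idem _) (self (a + b)).left,
      (self (b + a)).right.add hz (idem _) (self (b + a)).left⟩

theorem zero_add_self_comm (hz : ∀ a : S, IsZeroOf a (z a)) (a : S) :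
    z a + a = a + z a := by
  obtain ⟨n, ⟨h1, h2, h3, v, h4, h5, h6, h7⟩, -⟩ := (hz a).exists_inGroup
  have e1 := nmul_add_comm a n
  have l : z a + (a + z a) = a + z a := by
    nth_rw 2 3 [← h4]
    rw [← add_assoc a, ← e1, add_assoc, ← add_assoc, h2]
  have r : z a + a + z a = z a + a := by
    nth_rw 1 3 [← h5]
    rw [add_assoc v, e1, ← add_assoc, add_assoc, h3]
  rw [← r, add_assoc, l]

/-- An element dividing an idempotent to which it is a left unit lies in the `R`-class. -/
theorem AddFactor.exists_add_eq (hz : ∀ a : S, IsZeroOf a (z a)) {e u : S} (he : AddIdem e)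
    (h : AddFactor e u) (hu : e + u = u) : ∃ m, u + m = e := by
  obtain ⟨s₀, t₀, h0⟩ := h
  rw [AddIdem] at he
  obtain ⟨s, t, h1, h2, h3, h4⟩ : ∃ s t, e = s + u + t ∧ e + s = s ∧ s + e = s ∧ t + e = t :=
    ⟨e + s₀ + e, t₀ + e, by grind, by grind, by grind, by grind⟩
  have hs : AddRegular s := ⟨u + t, by grind⟩
  obtain ⟨k1, k2, k3, v, k4, k5, k6, k7⟩ := inGroup_zero_of_regular hz hs
  refine ⟨t + s, ?_⟩
  generalize z s = k at *
  have e1 : k + e = k := by rw [← k5, add_assoc, h3]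
  have e2 : k + e = e := by rw [h1, add_assoc s, ← add_assoc, k2]
  have e3 : k = e := e1.symm.trans e2
  subst e3
  have e4 : u + t = v := by
    calc u + t = v + s + (u + t) := by rw [k5, ← add_assoc, hu]
      _ = v := by rw [add_assoc, ← add_assoc s, ← h1, k7]
  rw [← add_assoc, e4, k5]

theorem exists_mem_Vplus (hz : ∀ a : S, IsZeroOf a (z a)) (a x : S) (h : AddFactor (z a) x) :
    ∃ y ∈ Vplus (a + z a), a + z a + y = z (a + z a + x) ∧ y + (a + z a) = z (x + a + z a) := by
  have he := zero_addIdem hz a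
  have hA : AddFactor (z a) (a + z a + x) :=
    ((zero_addFactor_self hz a).add hz he (AddFactor.refl he)).add hz he h
  rw [add_assoc x]
  have l : z a + (a + z a) = a + z a := by
    rw [← add_assoc, zero_add_self_comm hz, add_assoc, he]
  generalize z a = e at *
  generalize a + e = A at *
  obtain ⟨m, hm⟩ := hA.exists_add_eq hz he (by rw [← add_assoc, l])
  obtain ⟨k1, k2, k3, g, k4, k5, k6, k7⟩ := inGroup_zero_of_regular hz
    (a := A + x) ⟨m, by rw [hm, ← add_assoc, l]⟩
  generalize z (A + x) = E at *
  have hE : E + A = A := by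
    have : E + e = e := by rw [← hm, ← add_assoc, k2]
    rw [← l, ← add_assoc, this]
  refine ⟨x + g, ⟨?_, ?_⟩, ?_, ?_⟩
  · rw [← add_assoc, k4, hE]
  · rw [add_assoc (x + g), ← add_assoc A, k4, add_assoc, k7]
  · rw [← add_assoc, k4]
  · have hg : InGroup (x + A) (x + g + A) := by
      refine inGroup_of_add_eq (p := x + g + g + A) (q := x + g + g + A) ?_ ?_ ?_ ?_ ?_ <;> grind
    exact (zero_eq_of_inGroup hz (n := 0) hg).symm

theorem IsBLatticeCong.rel_zero {ξ : S → S → Prop} (hξ : IsBLatticeCong ξ)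
    (hz : ∀ a : S, IsZeroOf a (z a)) (a : S) : ξ (z a) a := by
  obtain ⟨hc, -, h2, h3⟩ := hξ
  obtain ⟨n, ⟨-, -, g3, v, g4, -⟩, -⟩ := (hz a).exists_inGroup
  have hn : ∀ m, ξ (nmul m a) a := fun m ↦ by
    induction m with
    | zero => exact hc.refl a
    | succ m ih => exact hc.trans (hc.addr a ih) (h2 a)
  have e1 : ξ (nmul n a + (nmul n a + v)) (nmul n a + v) := by
    rw [← add_assoc]
    exact hc.addr v (h2 _)
  rw [g4, g3] at e1
  exact hc.symm (hc.trans (hc.symm (hn n)) e1)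

theorem IsBLatticeCong.rel_of_mem_Vplus {ξ : S → S → Prop} (hξ : IsBLatticeCong ξ) {a y : S}
    (hy : y ∈ Vplus a) : ξ y a := by
  obtain ⟨hc, -, h2, h3⟩ := hξ
  obtain ⟨y1, y2⟩ := hy
  have aux : ∀ p q : S, p + q + p = p → ξ (p + q) p := fun p q h ↦ by
    have e1 : ξ (q + p + p) (p + q + p) := hc.addr p (h3 q p)
    have e2 : ξ (q + p + p) (q + p) := by
      rw [add_assoc]
      exact hc.addl q (h2 p)
    rw [h] at e1
    exact hc.trans (h3 p q) (hc.trans (hc.symm e2) e1)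
  exact hc.trans (hc.symm (aux y a y2)) (hc.trans (h3 y a) (aux a y y1))

theorem add_zero_eq_of_yrel (hz : ∀ a : S, IsZeroOf a (z a)) {a b x : S} (h : Yrel z a b)
    (hx : AddFactor (z a) x) :
    a + z a = z (a + z a + x) + b + z b + z (x + a + z a) := by
  obtain ⟨y, hy, h1, h2⟩ := exists_mem_Vplus hz a x hx
  have hyb : y ∈ Vplus (b + z b) := h ▸ hy
  rw [← h1, ← h2, add_assoc _ b]
  generalize a + z a = A at *
  generalize b + z b = B at *
  have e1 := hy.1
  have e2 := hyb.2
  calc A = A + (y + B + y) + A := by rw [e2, e1]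
    _ = _ := by simp only [add_assoc]

theorem Vplus_subset (hz : ∀ a : S, IsZeroOf a (z a)) {a b : S}
    (h : ∀ x ∈ Vplus (a + z a), a + z a = z (a + z a + x) + b + z b + z (x + a + z a) ∧
      b + z b = z (b + z b + x) + a + z a + z (x + b + z b)) :
    Vplus (a + z a) ⊆ Vplus (b + z b) := by
  intro x hx
  obtain ⟨h1, h2⟩ := h x hx
  obtain ⟨x1, x2⟩ := hx
  rw [add_assoc _ b, add_assoc x] at h1
  rw [add_assoc _ a, add_assoc x] at h2
  generalize a + z a = A at *
  generalize b + z b = B at *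
  have e1 : z (A + x) = A + x := AddIdem.zero_eq hz (by rw [AddIdem, ← add_assoc, x1])
  have e2 : z (x + A) = x + A := AddIdem.zero_eq hz (by rw [AddIdem, ← add_assoc, x2])
  rw [e1, e2] at h1
  have hx2 : x + B + x = x := by
    calc x + B + x = x + A + x + B + (x + A + x) := by rw [x2]
      _ = x + (A + x + B + (x + A)) + x := by simp only [add_assoc]
      _ = x := by rw [← h1, x2]
  have e3 : z (B + x) = B + x :=
    AddIdem.zero_eq hz (by rw [AddIdem, add_assoc, ← add_assoc x, hx2])
  have e4 : z (x + B) = x + B := AddIdem.zero_eq hz (by rw [AddIdem, ← add_assoc, hx2])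
  rw [e3, e4] at h2
  refine ⟨?_, hx2⟩
  calc B + x + B = B + (x + A + x) + B := by rw [x2]
    _ = B + x + A + (x + B) := by simp only [add_assoc]
    _ = B := h2.symm

end Zero

end PSemiring

open PSemiring

/-- In a quasi completely regular semiring with least b-lattice
congruence `ξ`, for `a, b` in the same `ξ`-class: `a 𝒴 b` iff for every `x` in
the `ξ`-class of `a`, `a+0_a = 0_{(a+0_a+x)}+b+0_b+0_{(x+a+0_a)}` and
`b+0_b = 0_{(b+0_b+x)}+a+0_a+0_{(x+b+0_b)}`. -/
theorem yrel_iff_zero_translations {S : Type*} [PSemiring S]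
    (hS : QuasiCompletelyRegular S) (z : S → S) (hz : ∀ a, IsZeroOf a (z a))
    (ξ : S → S → Prop) (hξ : IsLeastBLatticeCong ξ)
    (a b : S) (hab : ξ a b) :
    Yrel z a b ↔
      ∀ x : S, ξ x a →
        a + z a = z (a + z a + x) + b + z b + z (x + a + z a) ∧
        b + z b = z (b + z b + x) + a + z a + z (x + b + z b) := by
  have hB := hξ.1
  have hc := hB.1
  have hle : ∀ {c x : S}, ξ c x → AddFactor (z c) x := fun h ↦
    (hξ.2 _ (isBLatticeCong_zero hz) _ _ h).1
  have hadd : ∀ c : S, ξ (c + z c) c := fun c ↦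
    hc.trans (hc.addl c (hB.rel_zero hz c)) (hB.2.2.1 c)
  constructor
  · exact fun h x hx ↦ ⟨add_zero_eq_of_yrel hz h (hle (hc.symm hx)),
      add_zero_eq_of_yrel hz h.symm (hle (hc.symm (hc.trans hx hab)))⟩
  · intro h
    refine Set.Subset.antisymm (Vplus_subset hz fun x hx ↦ ?_) (Vplus_subset hz fun x hx ↦ ?_)
    · exact h x (hc.trans (hB.rel_of_mem_Vplus hx) (hadd a))
    · exact (h x (hc.trans (hB.rel_of_mem_Vplus hx)
        (hc.trans (hadd b) (hc.symm hab)))).symm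
end

section
/- Let S be a completely Archimedean semiring which is a nil-extension of a Rees matrix semiring K = M(I,R,Λ;P). Define a relation σ on S by: a σ b if and only if g − h ∈ ⟨P⟩, where a+0_a = (i,g,λ) and b+0_b = (j,h,μ) are the elements of K determined by a and b. Then σ is the least skew-ring congruence on S. -/
open PSemiring

/-- A skew-ring: a semiring whose additive reduct is a (not necessarily
abelian) group. -/
class SkewRing (R : Type*) extends AddGroup R, Semigroup R where
  left_distrib : ∀ a b c : R, a * (b + c) = a * b + a * c
  right_distrib : ∀ a b c : R, (a + b) * c = a * c + b * c

/-- The conditions on the bands `I`, `Λ` (with distinguished elements `oI`,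
`oΛ` playing the role of the common element `o`) and on the sandwich matrix
`P` in the definition of the Rees matrix semiring `M(I, R, Λ; P)`. -/
structure ReesData {R I Λ : Type*} [SkewRing R] [Semigroup I] [Semigroup Λ]
    (oI : I) (oΛ : Λ) (P : Λ → I → R) : Prop where
  band_I : ∀ i : I, i * i = i
  band_Λ : ∀ l : Λ, l * l = l
  zero_at_oI : ∀ l : Λ, P l oI = 0
  zero_at_oΛ : ∀ i : I, P oΛ i = 0
  cond_ii : ∀ (i j k : I) (l m n : Λ),
    P (l * m) (k * j) = P (l * m) (i * j) - P (n * m) (i * j) + P (n * m) (k * j)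
  cond_iii : ∀ (i j k : I) (l m n : Λ),
    P (m * l) (j * k) = P (m * l) (j * i) - P (m * n) (j * i) + P (m * n) (j * k)
  cond_iv_left : ∀ (a : R) (l : Λ) (i : I), a * P l i = 0
  cond_iv_right : ∀ (a : R) (l : Λ) (i : I), P l i * a = 0
  cond_v : ∀ (a b : R) (i : I) (m : Λ),
    a * b + P (oΛ * m) (i * oI) = P (oΛ * m) (i * oI) + a * b
  cond_vi : ∀ (a b : R) (j : I) (l : Λ),
    a * b + P (l * oΛ) (oI * j) = P (l * oΛ) (oI * j) + a * b

/-- `N` is a skew-ideal of the skew-ring `R`: a normal subgroup of `(R,+)`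
closed under multiplication by arbitrary elements of `R` on either side. -/
def IsSkewIdeal {R : Type*} [SkewRing R] (N : Set R) : Prop :=
  (0 : R) ∈ N ∧ (∀ a b : R, a ∈ N → b ∈ N → a + b ∈ N) ∧
  (∀ a : R, a ∈ N → -a ∈ N) ∧ (∀ (a n : R), n ∈ N → a + n + -a ∈ N) ∧
  ∀ (c n : R), n ∈ N → c * n ∈ N ∧ n * c ∈ N

/-- `⟨T⟩`, the smallest skew-ideal of `R` containing the set `T`. -/
def skewIdealGen {R : Type*} [SkewRing R] (T : Set R) : Set R :=
  ⋂₀ {N : Set R | IsSkewIdeal N ∧ T ⊆ N}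

namespace PSemiring

section Nmul

variable {S : Type*} [PSemiring S]

lemma nmul_add_nmul_s13 (a : S) (p q : ℕ) : nmul p a + nmul q a = nmul (p + q + 1) a := by
  induction q with
  | zero => rfl
  | succ q ih =>
    change nmul p a + (nmul q a + a) = nmul (p + q + 1) a + a
    rw [← add_assoc, ih]

lemma exists_nmul_nmul_eq (a : S) (m n : ℕ) : ∃ j, m ≤ j ∧ nmul m (nmul n a) = nmul j a := by
  induction m with
  | zero => exact ⟨n, Nat.zero_le _, rfl⟩
  | succ m ih =>
    obtain ⟨j, hj, h⟩ := ih
    refine ⟨j + n + 1, by omega, ?_⟩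
    change nmul m (nmul n a) + nmul n a = _
    rw [h, nmul_add_nmul_s13]

lemma nmul_succ' (a : S) (m : ℕ) : nmul (m + 1) a = a + nmul m a := by
  have := nmul_add_nmul_s13 a 0 m
  rw [Nat.zero_add] at this
  exact this.symm

lemma exists_eq_nmul_add {x y : S} (hy : y = y + x + y) (hc : y + x = x + y) (m : ℕ) :
    ∃ w, y = nmul m y + w := by
  have h1 : y = y + y + x := by
    conv_lhs => rw [hy, add_assoc, ← hc, ← add_assoc]
  induction m with
  | zero => exact ⟨y + x, by rw [← add_assoc]; exact h1⟩
  | succ m ih =>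
    obtain ⟨w, hw⟩ := ih
    refine ⟨w + x, ?_⟩
    rw [nmul_succ']
    calc y = y + y + x := h1
      _ = y + (nmul m y + w) + x := by rw [← hw]
      _ = y + nmul m y + (w + x) := by simp only [add_assoc]

lemma IsZeroOf.addIdem {a z : S} (h : IsZeroOf a z) : AddIdem z := by
  obtain ⟨n, x, -, hy, -, -, rfl⟩ := h
  unfold AddIdem
  rw [← add_assoc, ← hy]

lemma IsZeroOf.mem_ideal {a z : S} (h : IsZeroOf a z) {K : Set S}
    (hr : ∀ s, ∀ k ∈ K, k + s ∈ K)
    (ha : ∃ n, nmul n a ∈ K) : z ∈ K := by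
  obtain ⟨n, x, -, hy, -, hc, rfl⟩ := h
  obtain ⟨m, hm⟩ := ha
  have hge : ∀ j, m ≤ j → nmul j a ∈ K := fun j hj => by
    induction j, hj using Nat.le_induction with
    | base => exact hm
    | succ j _ ih => exact hr _ _ ih
  obtain ⟨w, hw⟩ := exists_eq_nmul_add hy hc m
  obtain ⟨j, hj, h⟩ := exists_nmul_nmul_eq a m n
  rw [hw, h]
  exact hr _ _ (hr _ _ (hge j hj))

lemma IsSkewRingCong.addIdem_rel {r : S → S → Prop} (h : IsSkewRingCong r) {e f : S}
    (he : AddIdem e) (hf : AddIdem f) : r e f := by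
  obtain ⟨hc, hs⟩ := h
  obtain ⟨x, hx⟩ := (hs e f).1
  obtain ⟨y, hy⟩ := (hs f e).2
  have h1 : r (e + f) f := by
    have := hc.addl e hx
    rw [← add_assoc, he] at this
    exact hc.trans (hc.symm this) hx
  have h2 : r (e + f) e := by
    have := hc.addr f hy
    rw [add_assoc, hf] at this
    exact hc.trans (hc.symm this) hy
  exact hc.trans (hc.symm h2) h1

lemma IsSkewRingCong.add_addIdem_rel {r : S → S → Prop} (h : IsSkewRingCong r) {e : S}
    (he : AddIdem e) (a : S) : r (a + e) a := by
  obtain ⟨hc, hs⟩ := h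
  obtain ⟨y, hy⟩ := (hs e a).2
  have := hc.addr e hy
  rw [add_assoc, he] at this
  exact hc.trans (hc.symm this) hy

lemma IsSkewRingCong.addIdem_add_rel {r : S → S → Prop} (h : IsSkewRingCong r) {e : S}
    (he : AddIdem e) (a : S) : r (e + a) a := by
  obtain ⟨hc, hs⟩ := h
  obtain ⟨x, hx⟩ := (hs e a).1
  have := hc.addl e hx
  rw [← add_assoc, he] at this
  exact hc.trans (hc.symm this) hx

end Nmul

end PSemiring

section SkewIdeal

variable {R : Type*} [SkewRing R]

lemma SkewRing.mul_zero' (c : R) : c * 0 = 0 := by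
  have h := SkewRing.left_distrib c 0 0
  rw [add_zero] at h
  exact left_eq_add.mp h

lemma SkewRing.zero_mul' (c : R) : 0 * c = 0 := by
  have h := SkewRing.right_distrib 0 0 c
  rw [add_zero] at h
  exact left_eq_add.mp h

lemma SkewRing.mul_neg' (c a : R) : c * -a = -(c * a) := by
  have h := SkewRing.left_distrib c (-a) a
  rw [neg_add_cancel, SkewRing.mul_zero'] at h
  exact eq_neg_of_add_eq_zero_left h.symm

lemma SkewRing.neg_mul' (c a : R) : -a * c = -(a * c) := by
  have h := SkewRing.right_distrib (-a) a c
  rw [neg_add_cancel, SkewRing.zero_mul'] at h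
  exact eq_neg_of_add_eq_zero_left h.symm

lemma isSkewIdeal_skewIdealGen (T : Set R) : IsSkewIdeal (skewIdealGen T) := by
  refine ⟨fun N hN => hN.1.1, fun a b ha hb N hN => hN.1.2.1 a b (ha N hN) (hb N hN),
    fun a ha N hN => hN.1.2.2.1 a (ha N hN), fun a n hn N hN => hN.1.2.2.2.1 a n (hn N hN),
    fun c n hn => ⟨fun N hN => (hN.1.2.2.2.2 c n (hn N hN)).1,
      fun N hN => (hN.1.2.2.2.2 c n (hn N hN)).2⟩⟩

lemma subset_skewIdealGen (T : Set R) : T ⊆ skewIdealGen T := fun _ hx _ hN => hN.2 hx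

lemma skewIdealGen_subset {T N : Set R} (hN : IsSkewIdeal N) (hT : T ⊆ N) :
    skewIdealGen T ⊆ N := fun _ hx => hx N ⟨hN, hT⟩

/-- The additive subgroup underlying a skew-ideal. -/
def IsSkewIdeal.toAddSubgroup {N : Set R} (hN : IsSkewIdeal N) : AddSubgroup R where
  carrier := N
  zero_mem' := hN.1
  add_mem' := hN.2.1 _ _
  neg_mem' := hN.2.2.1 _

lemma IsSkewIdeal.normal {N : Set R} (hN : IsSkewIdeal N) : hN.toAddSubgroup.Normal :=
  ⟨fun n hn a => hN.2.2.2.1 a n hn⟩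

lemma IsSkewIdeal.mul_sub_mul_mem {N : Set R} (hN : IsSkewIdeal N) (c : R) {g h : R}
    (H : g - h ∈ N) : c * g - c * h ∈ N ∧ g * c - h * c ∈ N := by
  have := hN.2.2.2.2 c _ H
  rwa [sub_eq_add_neg, SkewRing.left_distrib, SkewRing.right_distrib, SkewRing.mul_neg',
    SkewRing.neg_mul', ← sub_eq_add_neg, ← sub_eq_add_neg] at this

end SkewIdeal

/-- Let `S` be a completely Archimedean semiring which is a
nil-extension of a Rees matrix semiring `K = M(I, R, Λ; P)`; here `K` is
realized as the range of an injective map `ι : I × R × Λ → S` respecting the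
Rees matrix operations, whose range is an ideal of `S`, and every element of
`S` has a positive multiple in `K`.  Define `σ` by `a σ b` iff `g - h ∈ ⟨P⟩`,
where `a + 0_a = ι (i, g, l)` and `b + 0_b = ι (j, h, m)`.  Then `σ` is the
least skew-ring congruence on `S`. -/
theorem sigma_least_skewRing_cong {S R I Λ : Type*} [PSemiring S] [SkewRing R]
    [Semigroup I] [Semigroup Λ] (oI : I) (oΛ : Λ) (P : Λ → I → R)
    (hP : ReesData oI oΛ P)
    (hCA : CompletelyArchimedean S)
    (ι : I × R × Λ → S) (hinj : Function.Injective ι)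
    (hadd : ∀ (i j : I) (g h : R) (l m : Λ),
      ι (i, g, l) + ι (j, h, m) = ι (i, g + P l j + h, m))
    (hmul : ∀ (i j : I) (g h : R) (l m : Λ),
      ι (i, g, l) * ι (j, h, m) = ι (i * j, -P (l * m) (i * j) + g * h, l * m))
    (hideal : ∀ s : S, ∀ k ∈ Set.range ι,
      s + k ∈ Set.range ι ∧ k + s ∈ Set.range ι ∧
      s * k ∈ Set.range ι ∧ k * s ∈ Set.range ι)
    (hnil : ∀ a : S, ∃ n : ℕ, nmul n a ∈ Set.range ι)
    (z : S → S) (hz : ∀ a, IsZeroOf a (z a)) :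
    IsLeastSkewRingCong (fun a b : S =>
      ∃ (i j : I) (g h : R) (l m : Λ),
        ι (i, g, l) = a + z a ∧ ι (j, h, m) = b + z b ∧
        g - h ∈ skewIdealGen {x : R | ∃ (l' : Λ) (i' : I), x = P l' i'}) := by
  have hzi : ∀ a, z a + z a = z a := fun a => (hz a).addIdem
  have hzK : ∀ a, z a ∈ Set.range ι := fun a => (hz a).mem_ideal
    (fun s k hk => (hideal s k hk).2.1) (hnil a)
  have hazK : ∀ a, a + z a ∈ Set.range ι := fun a => (hideal a _ (hzK a)).1
  have hE : AddIdem (ι (oI, 0, oΛ)) := by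
    simp [AddIdem, hadd, hP.zero_at_oI]
  refine ⟨?_, ?_⟩
  · set T : Set R := {x : R | ∃ (l' : Λ) (i' : I), x = P l' i'}
    have hN := isSkewIdeal_skewIdealGen T
    have := hN.normal
    set q : R →+ R ⧸ hN.toAddSubgroup := QuotientAddGroup.mk' _
    have q_eq : ∀ g h, q g = q h ↔ g - h ∈ skewIdealGen T := fun g h =>
      QuotientAddGroup.eq_iff_sub_mem
    have q_P : ∀ l i, q (P l i) = 0 := fun l i => by
      rw [← map_zero q, q_eq, sub_zero]
      exact subset_skewIdealGen T ⟨l, i, rfl⟩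
    set φ : S → R ⧸ hN.toAddSubgroup := Function.extend ι (fun x => q x.2.1) 0
    have φι : ∀ i g l, φ (ι (i, g, l)) = q g := fun i g l => hinj.extend_apply _ _ _
    have φ_add : ∀ s ∈ Set.range ι, ∀ t ∈ Set.range ι, φ (s + t) = φ s + φ t := by
      rintro _ ⟨⟨i, g, l⟩, rfl⟩ _ ⟨⟨j, h, m⟩, rfl⟩
      simp [hadd, φι, q_P]
    have φ_idem : ∀ s ∈ Set.range ι, s + s = s → φ s = 0 := fun s hs h => by
      have := φ_add s hs s hs
      rw [h] at this
      exact left_eq_add.mp this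
    set ψ : S → R ⧸ hN.toAddSubgroup := fun a => φ (a + z a)
    have ψ_right : ∀ a, ∀ k ∈ Set.range ι, φ (a + k) = ψ a + φ k := fun a k hk => by
      have hk' := (hideal a k hk).1
      have h1 := φ_add _ (hazK a) _ hk
      have h2 : φ (z a + a + k) = φ (a + k) := by
        rw [add_assoc, φ_add _ (hzK a) _ hk', φ_idem _ (hzK a) (hzi a), zero_add]
      have h3 : φ (z a + a) = ψ a := by
        have ha := (hideal a _ (hzK a)).2.1
        have h4 := φ_add _ ha _ (hzK a)
        rw [add_assoc, φ_add _ (hzK a) _ (hazK a), φ_idem _ (hzK a) (hzi a), zero_add,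
          add_zero] at h4
        exact h4.symm
      rw [← h2, φ_add _ (hideal a _ (hzK a)).2.1 _ hk, h3]
    have ψ_of_idem : ∀ a, ∀ k ∈ Set.range ι, k + k = k → φ (a + k) = ψ a := fun a k hk h => by
      rw [ψ_right a k hk, φ_idem k hk h, add_zero]
    have ψ_K : ∀ k ∈ Set.range ι, ψ k = φ k := fun k hk => by
      change φ (k + z k) = _
      rw [φ_add _ hk _ (hzK k), φ_idem _ (hzK k) (hzi k), add_zero]
    have ψ_add : ∀ a b, ψ (a + b) = ψ a + ψ b := fun a b => by
      have hk : ι (oI, 0, oΛ) ∈ Set.range ι := ⟨_, rfl⟩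
      rw [← ψ_of_idem (a + b) _ hk hE, add_assoc, ψ_right a _ (hideal b _ hk).1,
        ψ_of_idem b _ hk hE]
    have ψ_mul : ∀ a b, ψ (a * b) = φ ((a + z a) * (b + z b)) := fun a b => by
      have h1 : φ (a * z b) = 0 := φ_idem _ (hideal a _ (hzK b)).2.2.1 (by
        rw [← PSemiring.left_distrib, hzi])
      have hk1 := (hideal b _ (hzK a)).2.2.2
      have h2 : φ (z a * b) = 0 := φ_idem _ hk1 (by
        rw [← PSemiring.right_distrib, hzi])
      have hk2 := (hideal (z a) _ (hzK b)).2.2.1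
      have h3 : φ (z a * z b) = 0 := φ_idem _ hk2 (by
        rw [← PSemiring.left_distrib, hzi])
      have hk3 := (hideal (z a * b) _ hk2).1
      have hk4 := (hideal (a * z b) _ hk3).1
      rw [PSemiring.right_distrib, PSemiring.left_distrib, PSemiring.left_distrib, add_assoc,
        ψ_right _ _ hk4, φ_add _ (hideal a _ (hzK b)).2.2.1 _ hk3, φ_add _ hk1 _ hk2, h1, h2, h3]
      simp
    have σ_iff : ∀ a b : S, (∃ (i j : I) (g h : R) (l m : Λ),
        ι (i, g, l) = a + z a ∧ ι (j, h, m) = b + z b ∧ g - h ∈ skewIdealGen T) ↔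
        ψ a = ψ b := by
      intro a b
      constructor
      · rintro ⟨i, j, g, h, l, m, h1, h2, h3⟩
        change φ (a + z a) = φ (b + z b)
        rw [← h1, ← h2, φι, φι, q_eq]
        exact h3
      · intro H
        obtain ⟨⟨i, g, l⟩, h1⟩ := hazK a
        obtain ⟨⟨j, h, m⟩, h2⟩ := hazK b
        refine ⟨i, j, g, h, l, m, h1, h2, ?_⟩
        change φ (a + z a) = φ (b + z b) at H
        rwa [← h1, ← h2, φι, φι, q_eq] at H
    have ψ_surj : ∀ y, ∃ a, ψ a = y := fun y => by
      obtain ⟨g, rfl⟩ := QuotientAddGroup.mk'_surjective _ y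
      exact ⟨ι (oI, g, oΛ), by rw [ψ_K _ ⟨_, rfl⟩, φι]⟩
    have ψ_mul_congr : ∀ c a b, ψ a = ψ b →
        ψ (c * a) = ψ (c * b) ∧ ψ (a * c) = ψ (b * c) := fun c a b H => by
      rw [← σ_iff] at H
      obtain ⟨i, j, g, h, l, m, h1, h2, h3⟩ := H
      obtain ⟨⟨i', g', l'⟩, hc⟩ := hazK c
      have h4 := hN.mul_sub_mul_mem g' h3
      simp only [ψ_mul, ← h1, ← h2, ← hc, hmul, φι, map_add, map_neg, q_P, neg_zero, zero_add]
      exact ⟨(q_eq _ _).2 h4.1, (q_eq _ _).2 h4.2⟩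
    refine ⟨⟨?_, ?_, ?_, ?_, ?_, ?_, ?_⟩, ?_⟩
    all_goals simp only [σ_iff]
    · exact fun _ => trivial
    · exact fun h => h.symm
    · exact fun h h' => h.trans h'
    · intro c a b h
      rw [ψ_add, ψ_add, h]
    · intro c a b h
      rw [ψ_add, ψ_add, h]
    · exact fun c a b h => (ψ_mul_congr c a b h).1
    · exact fun c a b h => (ψ_mul_congr c a b h).2
    · intro a b
      obtain ⟨x, hx⟩ := ψ_surj (-ψ a + ψ b)
      obtain ⟨y, hy⟩ := ψ_surj (ψ b - ψ a)
      exact ⟨⟨x, by simp [ψ_add, hx]⟩, ⟨y, by simp [ψ_add, hy]⟩⟩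
  · rintro r hr a b ⟨i, j, g, h, l, m, h1, h2, h3⟩
    have hc := hr.1
    set u : R → S := fun g => ι (oI, g, oΛ) with hu
    have u_add : ∀ g h, u g + u h = u (g + h) := fun g h => by
      simp [hu, hadd, hP.zero_at_oI]
    have u_mul : ∀ g h, u g * u h = u (g * h) := fun g h => by
      simp [hu, hmul, hP.zero_at_oI, hP.band_I, hP.band_Λ]
    have hE0 : AddIdem (u 0) := hE
    have hι : ∀ i g l, r (ι (i, g, l)) (u g) := fun i g l => by
      have e1 : AddIdem (ι (i, 0, oΛ)) := by simp [AddIdem, hadd, hP.zero_at_oΛ]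
      have e2 : AddIdem (ι (oI, 0, l)) := by simp [AddIdem, hadd, hP.zero_at_oI]
      have h : ι (i, g, l) = ι (i, 0, oΛ) + u g + ι (oI, 0, l) := by
        simp [hu, hadd, hP.zero_at_oI]
      rw [h]
      exact hc.trans (hr.add_addIdem_rel e2 _) (hr.addIdem_add_rel e1 _)
    have u_neg : ∀ g, r (u g) (u 0) → r (u (-g)) (u 0) := fun g hg => by
      have := hc.addl (u (-g)) hg
      rw [u_add, u_add, neg_add_cancel, add_zero] at this
      exact hc.symm this
    have hM : IsSkewIdeal {g | r (u g) (u 0)} := by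
      refine ⟨hc.refl _, fun a b ha hb => ?_, u_neg, fun a n hn => ?_, fun c n hn => ⟨?_, ?_⟩⟩
      · have := hc.trans (hc.addr (u b) ha) (hc.addl (u 0) hb)
        simpa only [Set.mem_ofPred_eq, u_add, add_zero] using this
      · have := hc.addr (u (-a)) (hc.addl (u a) hn)
        simpa only [Set.mem_ofPred_eq, u_add, add_zero, add_neg_cancel] using this
      · have := hc.mull (u c) hn
        simpa only [Set.mem_ofPred_eq, u_mul, SkewRing.mul_zero'] using this
      · have := hc.mulr (u c) hn
        simpa only [Set.mem_ofPred_eq, u_mul, SkewRing.zero_mul'] using this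
    have hPM : {x : R | ∃ (l' : Λ) (i' : I), x = P l' i'} ⊆ {g | r (u g) (u 0)} := by
      rintro _ ⟨l', i', rfl⟩
      have e : AddIdem (ι (i', -P l' i', l')) := by simp [AddIdem, hadd]
      have := u_neg _ (hc.trans (hc.symm (hι _ _ _)) (hr.addIdem_rel e hE0))
      rwa [neg_neg] at this
    have h4 : r (u g) (u h) := by
      have := hc.addr (u h) (skewIdealGen_subset hM hPM h3)
      simpa only [u_add, sub_add_cancel, zero_add] using this
    have h5 : ∀ a, r a (a + z a) := fun a => hc.symm (hr.add_addIdem_rel (hzi a) a)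
    have h6 : r a (u g) := hc.trans (h5 a) (h1 ▸ hι i g l)
    have h7 : r b (u h) := hc.trans (h5 b) (h2 ▸ hι j h m)
    exact hc.trans h6 (hc.trans h4 (hc.symm h7))
end
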